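/- For any integer n ≥ 2, there is no positive C² function u : ℝⁿ → ℝ satisfying the soliton equation div(Du/√(1+|Du|²)) + (1+nu)/(u²√(1+|Du|²)) = 0 (equivalently Δu − (D²u)(Du,Du)/(1+|Du|²) + (1+nu)/u² = 0) on all of ℝⁿ. -/

import Mathlib

open Set Filter Topology

/-- Partial derivative `∂u/∂xᵢ` (Euclidean). -/
noncomputable def pd (n : ℕ) (u : EuclideanSpace ℝ (Fin n) → ℝ) (i : Fin n)
    (x : EuclideanSpace ℝ (Fin n)) : ℝ :=
  fderiv ℝ u x (EuclideanSpace.single i 1)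

/-- Second partial derivative `∂²u/∂xᵢ∂xⱼ` (Euclidean). -/
noncomputable def pd2 (n : ℕ) (u : EuclideanSpace ℝ (Fin n) → ℝ) (i j : Fin n)
    (x : EuclideanSpace ℝ (Fin n)) : ℝ :=
  fderiv ℝ (fun y => fderiv ℝ u y (EuclideanSpace.single j 1)) x (EuclideanSpace.single i 1)

/-- `|Du|²`, the squared Euclidean norm of the gradient. -/
noncomputable def gradNormSq (n : ℕ) (u : EuclideanSpace ℝ (Fin n) → ℝ)
    (x : EuclideanSpace ℝ (Fin n)) : ℝ :=
  ∑ i, (pd n u i x) ^ 2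

/-- The Euclidean Laplacian `Δu`. -/
noncomputable def lap (n : ℕ) (u : EuclideanSpace ℝ (Fin n) → ℝ)
    (x : EuclideanSpace ℝ (Fin n)) : ℝ :=
  ∑ i, pd2 n u i i x

/-- The Hessian quadratic form evaluated on the gradient, `(D²u)(Du,Du)`. -/
noncomputable def hessQuad (n : ℕ) (u : EuclideanSpace ℝ (Fin n) → ℝ)
    (x : EuclideanSpace ℝ (Fin n)) : ℝ :=
  ∑ i, ∑ j, pd2 n u i j x * pd n u i x * pd n u j x

/-- The soliton equation (SE): `Δu − (D²u)(Du,Du)/(1+|Du|²) = −(1+nu)/u²` on `Ω`,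
which is the non-divergence form of `div(Du/√(1+|Du|²)) = −(1+nu)/(u²√(1+|Du|²))`. -/
def SolvesSE (n : ℕ) (Ω : Set (EuclideanSpace ℝ (Fin n)))
    (u : EuclideanSpace ℝ (Fin n) → ℝ) : Prop :=
  ∀ x ∈ Ω, lap n u x - hessQuad n u x / (1 + gradNormSq n u x) = -(1 + n * u x) / (u x) ^ 2

/-- The second-order necessary condition for a local minimum of a function of one variable. -/
theorem deriv_deriv_nonneg_of_isLocalMin {g : ℝ → ℝ} {a : ℝ} (hg : IsLocalMin g a)
    (hc : ContinuousAt g a) : 0 ≤ deriv (deriv g) a := by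
  by_contra! h
  have hmax : IsLocalMax g a := isLocalMax_of_deriv_deriv_neg h hg.deriv_eq_zero hc
  have hconst : g =ᶠ[𝓝 a] fun _ => g a := by
    filter_upwards [hg, hmax] with t h₁ h₂ using le_antisymm h₂ h₁
  have hderiv : deriv (deriv g) a = 0 := by
    rw [hconst.deriv.deriv_eq]
    simp
  exact h.ne hderiv

/-- A matrix whose quadratic form is nonnegative satisfies `⟨A p, p⟩ ≤ tr A * |p|²`. -/
theorem sum_sum_mul_le_trace_mul {ι : Type*} [Fintype ι] (A : ι → ι → ℝ) (p : ι → ℝ)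
    (hA : ∀ i j (a b : ℝ),
      0 ≤ a ^ 2 * A i i + a * b * A i j + a * b * A j i + b ^ 2 * A j j) :
    ∑ i, ∑ j, A i j * p i * p j ≤ (∑ i, A i i) * ∑ i, p i ^ 2 := by
  have h : 0 ≤ ∑ i, ∑ j, ((A i i * p j ^ 2 - A i j * p i * p j) +
      (A j j * p i ^ 2 - A j i * p j * p i)) :=
    Finset.sum_nonneg fun i _ => Finset.sum_nonneg fun j _ => by
      have := hA i j (p j) (-p i)
      linarith
  simp_rw [Finset.sum_add_distrib] at h
  rw [Finset.sum_comm (f := fun i j => A j j * p i ^ 2 - A j i * p j * p i)] at h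
  simp_rw [Finset.sum_sub_distrib, ← Finset.mul_sum, ← Finset.sum_mul] at h
  linarith

/-- At a minimum point of `‖x‖² + u²` the second variation of `(‖x‖² + u²) / 2` is nonnegative. -/
theorem second_variation_nonneg {E : Type*} [NormedAddCommGroup E] [InnerProductSpace ℝ E]
    {u : E → ℝ} (hu : ContDiff ℝ 2 u) {x : E}
    (hx : ∀ y, ‖x‖ ^ 2 + u x ^ 2 ≤ ‖y‖ ^ 2 + u y ^ 2) (v : E) :
    0 ≤ inner ℝ v v + fderiv ℝ u x v ^ 2 + u x * fderiv ℝ (fderiv ℝ u) x v v := by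
  set g : ℝ → ℝ := fun t => ‖x + t • v‖ ^ 2 + u (x + t • v) ^ 2 with hg
  have hline (t : ℝ) : HasDerivAt (fun t : ℝ => x + t • v) v t := by
    simpa using ((hasDerivAt_id t).smul_const v).const_add x
  have hut (t : ℝ) : HasDerivAt (fun t : ℝ => u (x + t • v)) (fderiv ℝ u (x + t • v) v) t :=
    ((hu.differentiable (by norm_num)).differentiableAt.hasFDerivAt).comp_hasDerivAt t (hline t)
  have hg' (t : ℝ) : HasDerivAt g
      (2 * inner ℝ (x + t • v) v + 2 * (u (x + t • v) * fderiv ℝ u (x + t • v) v)) t := by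
    refine ((hline t).norm_sq.fun_add ((hut t).fun_pow 2)).congr_deriv ?_
    ring
  have hdu : Differentiable ℝ (fderiv ℝ u) :=
    (hu.fderiv_right (m := 1) (by norm_num)).differentiable (by norm_num)
  have hDu : HasDerivAt (fun t : ℝ => fderiv ℝ u (x + t • v) v)
      (fderiv ℝ (fderiv ℝ u) x v v) 0 := by
    have h := (hdu (x + (0 : ℝ) • v)).hasFDerivAt.comp_hasDerivAt 0 (hline 0)
    simpa using h.clm_apply (hasDerivAt_const 0 v)
  have hg'' : HasDerivAt (deriv g) (2 * inner ℝ v v +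
      2 * (fderiv ℝ u x v * fderiv ℝ u x v + u x * fderiv ℝ (fderiv ℝ u) x v v)) 0 := by
    rw [funext fun t => (hg' t).deriv]
    have h₁ := ((hline 0).inner ℝ (hasDerivAt_const 0 v)).const_mul 2
    have h₂ := ((hut 0).mul hDu).const_mul 2
    simpa using h₁.fun_add h₂
  have hmin : IsLocalMin g 0 := Eventually.of_forall fun t => by simpa [hg] using hx (x + t • v)
  have h := deriv_deriv_nonneg_of_isLocalMin hmin (hg' 0).continuousAt
  rw [hg''.deriv] at h
  linarith

/-- In a proper space `‖x‖² + u²` attains its minimum. -/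
theorem exists_forall_norm_sq_add_sq_le {E : Type*} [NormedAddCommGroup E] [ProperSpace E]
    {u : E → ℝ} (hu : Continuous u) :
    ∃ x, ∀ y, ‖x‖ ^ 2 + u x ^ 2 ≤ ‖y‖ ^ 2 + u y ^ 2 := by
  refine Continuous.exists_forall_le (by fun_prop) ?_
  refine tendsto_atTop_mono (fun y => le_add_of_nonneg_right (sq_nonneg (u y))) ?_
  exact (tendsto_pow_atTop two_ne_zero).comp (tendsto_norm_cocompact_atTop (E := E))

/-- for `n ≥ 2` there is no positive `C²` solution of the soliton
equation on the entire `ℝⁿ`. -/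
theorem no_entire_positive_solution_of_SE (n : ℕ) (hn : 2 ≤ n) :
    ¬ ∃ u : EuclideanSpace ℝ (Fin n) → ℝ,
        ContDiff ℝ 2 u ∧ (∀ x, 0 < u x) ∧ SolvesSE n Set.univ u := by
  rintro ⟨u, hu, hpos, hSE⟩
  obtain ⟨x, hx⟩ := exists_forall_norm_sq_add_sq_le hu.continuous
  have hdu : Differentiable ℝ (fderiv ℝ u) :=
    (hu.fderiv_right (m := 1) (by norm_num)).differentiable (by norm_num)
  have hpd2 (i j : Fin n) : pd2 n u i j x = fderiv ℝ (fderiv ℝ u) x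
      (EuclideanSpace.single i 1) (EuclideanSpace.single j 1) := by
    rw [pd2, fderiv_clm_apply (hdu x) (differentiableAt_const _)]
    simp
  set A : Fin n → Fin n → ℝ := fun i j =>
    (if i = j then 1 else 0) + pd n u i x * pd n u j x + u x * pd2 n u i j x with hAdef
  have hA (i j : Fin n) (a b : ℝ) :
      0 ≤ a ^ 2 * A i i + a * b * A i j + a * b * A j i + b ^ 2 * A j j := by
    have h := second_variation_nonneg hu hx
      (a • EuclideanSpace.single i (1 : ℝ) + b • EuclideanSpace.single j (1 : ℝ))
    have hinner (k l : Fin n) : inner ℝ (EuclideanSpace.single k (1 : ℝ))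
        (EuclideanSpace.single l (1 : ℝ)) = if k = l then (1 : ℝ) else 0 := by
      simp [EuclideanSpace.inner_single_left]
    simp only [inner_add_left, inner_add_right, real_inner_smul_left, real_inner_smul_right,
      hinner, map_add, map_smul, add_apply, smul_apply,
      smul_eq_mul, ← hpd2] at h
    simp only [hAdef, pd]
    linarith
  set s := gradNormSq n u x with hs
  have hs0 : 0 ≤ s := Finset.sum_nonneg fun i _ => sq_nonneg _
  have htr : ∑ i, A i i = n + s + u x * lap n u x := by
    simp [hAdef, hs, gradNormSq, lap, Finset.sum_add_distrib, Finset.mul_sum, sq]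
  have htr0 : 0 ≤ ∑ i, A i i := Finset.sum_nonneg fun i _ => by simpa using hA i i 1 0
  have hquad : ∑ i, ∑ j, A i j * pd n u i x * pd n u j x
      = s + s ^ 2 + u x * hessQuad n u x := by
    have hsq : s ^ 2 = ∑ i, ∑ j, pd n u i x * pd n u j x * pd n u i x * pd n u j x := by
      rw [hs, gradNormSq, sq, Finset.sum_mul_sum]
      exact Finset.sum_congr rfl fun i _ => Finset.sum_congr rfl fun j _ => by ring
    rw [hsq, hs, gradNormSq, hessQuad]
    simp [hAdef, add_mul, Finset.sum_add_distrib, Finset.mul_sum, sq, mul_assoc]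
  have hle := sum_sum_mul_le_trace_mul A (fun i => pd n u i x) hA
  rw [hquad, show ∑ i, pd n u i x ^ 2 = s from rfl] at hle
  have hux := hpos x
  have hM : (1 + s) * lap n u x - hessQuad n u x = (1 + s) * (-(1 + n * u x) / u x ^ 2) := by
    rw [← hSE x (mem_univ x), ← hs]
    field_simp
  have hM' : u x * ((1 + s) * lap n u x - hessQuad n u x) = -(1 + s) * (1 / u x + n) := by
    rw [hM]
    field_simp
  have hneg : 0 < (1 + s) * (1 / u x) := by positivity
  rw [htr] at hle htr0
  nlinarith
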